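/- Let d ≥ 1, let φ ∈ 𝒮(ℝ^d;ℝ), and fix i, j ∈ {1,…,d}. For 0 < δ₁ < δ₂ define K'_{i,j}(x) = ∫_{δ₁}^{δ₂} (∂(x_j φ)/∂x_i)(x/δ) δ^{−d−1} dδ. Then there exists a constant C > 0, depending only on φ and the dimension d and in particular independent of δ₁ and δ₂, such that: (a) |K'_{i,j}(x)| ≤ C|x|^{−d} for all x ≠ 0; (b) |∇K'_{i,j}(x)| ≤ C|x|^{−d−1} for all x ≠ 0; and (c) |K̂'_{i,j}(ξ)| ≤ C for all ξ ∈ ℝ^d, where K̂'_{i,j} denotes the Fourier transform. Equivalently, ‖K'_{i,j}‖_{CZ} ≤ C uniformly in 0 < δ₁ < δ₂. -/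

import Mathlib

open MeasureTheory Filter
open scoped ENNReal FourierTransform SchwartzMap

noncomputable section

/-- `ℝ^d`. -/
abbrev Eu (d : ℕ) := EuclideanSpace ℝ (Fin d)

/-- Rescaled mollifier `φ_δ(x) = δ^{-d} φ(x/δ)`. -/
def moll {d : ℕ} (φ : Eu d → ℝ) (δ : ℝ) (x : Eu d) : ℝ := (δ ^ d)⁻¹ * φ (δ⁻¹ • x)

/-- Convolution of scalar functions on `ℝ^d`. -/
def cnv {d : ℕ} (f g : Eu d → ℝ) (x : Eu d) : ℝ := ∫ y, f y * g (x - y)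

/-- `i`-th partial derivative. -/
def pd {d : ℕ} (f : Eu d → ℝ) (i : Fin d) (x : Eu d) : ℝ :=
  fderiv ℝ f x (EuclideanSpace.single i 1)

/-- Smooth compactly supported test functions. -/
def IsTest {d : ℕ} (φ : Eu d → ℝ) : Prop := ContDiff ℝ (⊤ : ℕ∞) φ ∧ HasCompactSupport φ

/-- Divergence free in the weak sense: `∫ u·∇φ = 0` for all test functions `φ`. -/
def DivFree {d : ℕ} (u : Eu d → Eu d) : Prop :=
  ∀ φ : Eu d → ℝ, IsTest φ → ∫ x, fderiv ℝ φ x (u x) = 0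

/-- `du` is the weak (distributional) gradient of `u`, componentwise:
`∫ u_i ∂_j φ = −∫ (du)_{ij} φ` for all test functions `φ`. -/
def HasWeakGrad {d : ℕ} (u : Eu d → Eu d) (du : Eu d → (Eu d →L[ℝ] Eu d)) : Prop :=
  ∀ (i j : Fin d) (φ : Eu d → ℝ), IsTest φ →
    ∫ x, u x i * pd φ j x = - ∫ x, (du x (EuclideanSpace.single j 1)) i * φ x

/-- The commutator `R(x) = u(x)·(ρ*∇K)(x) − Σ_i ((u_i ρ)*∂_i K)(x)`. -/
def DLcomm {d : ℕ} (u : Eu d → Eu d) (ρ : Eu d → ℝ) (K : Eu d → ℝ) (x : Eu d) : ℝ :=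
  (∑ i, u x i * ∫ y, ρ y * pd K i (x - y)) -
    ∑ i, ∫ y, (u y i * ρ y) * pd K i (x - y)

open LineDeriv

lemma aux_decay {d : ℕ} {F : Type*} [NormedAddCommGroup F] [NormedSpace ℝ F]
    (f : 𝓢(Eu d, F)) (k : ℕ) :
    ∃ A : ℝ, 0 < A ∧ ∀ y, ‖y‖ ^ k * (1 + ‖y‖ ^ 2) * ‖f y‖ ≤ A := by
  obtain ⟨A, hA, h1⟩ := f.decay k 0
  obtain ⟨B, hB, h2⟩ := f.decay (k + 2) 0
  refine ⟨A + B, by positivity, fun y => ?_⟩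
  have a1 := h1 y
  have a2 := h2 y
  rw [norm_iteratedFDeriv_zero] at a1 a2
  calc _ = ‖y‖ ^ k * ‖f y‖ + ‖y‖ ^ (k + 2) * ‖f y‖ := by ring
    _ ≤ _ := add_le_add a1 a2

lemma aux_int (r : ℝ) (hr : 0 < r) : Integrable (fun t : ℝ => r * (1 + (r * t) ^ 2)⁻¹) :=
  (integrable_inv_one_add_sq.comp_mul_left' hr.ne').const_mul r

lemma aux_int_le (r : ℝ) (hr : 0 < r) (s : Set ℝ) :
    ∫ t in s, r * (1 + (r * t) ^ 2)⁻¹ ≤ Real.pi := by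
  have h1 : ∫ t in s, r * (1 + (r * t) ^ 2)⁻¹ ≤ ∫ t, r * (1 + (r * t) ^ 2)⁻¹ :=
    setIntegral_le_integral (aux_int r hr) (Eventually.of_forall fun t => by positivity)
  refine h1.trans_eq ?_
  rw [integral_const_mul, Measure.integral_comp_mul_left (fun t : ℝ => (1 + t ^ 2)⁻¹) r,
    integral_univ_inv_one_add_sq, abs_of_pos (by positivity), smul_eq_mul]
  field_simp

lemma aux_kernel {d : ℕ} {F : Type*} [NormedAddCommGroup F] [NormedSpace ℝ F]
    (f : Eu d → F) (k : ℕ) (A : ℝ) (hA : 0 < A)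
    (hf : ∀ y, ‖y‖ ^ k * (1 + ‖y‖ ^ 2) * ‖f y‖ ≤ A) (a b : ℝ) (ha : 0 < a)
    (x : Eu d) (hx : x ≠ 0) :
    ‖∫ t in Set.Ioc a b, (t ^ (k + 2))⁻¹ • f (t⁻¹ • x)‖ ≤ A * Real.pi * (‖x‖ ^ (k + 1))⁻¹ := by
  have hr : 0 < ‖x‖ := norm_pos_iff.2 hx
  have key : ∀ t ∈ Set.Ioc a b, ‖(t ^ (k + 2))⁻¹ • f (t⁻¹ • x)‖ ≤
      (A * (‖x‖ ^ (k + 1))⁻¹) * (‖x‖⁻¹ * (1 + (‖x‖⁻¹ * t) ^ 2)⁻¹) := by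
    intro t ht
    have ht0 : 0 < t := ha.trans ht.1
    have h := hf (t⁻¹ • x)
    rw [norm_smul, Real.norm_of_nonneg (by positivity)] at h
    rw [norm_smul, Real.norm_of_nonneg (by positivity)]
    set r := ‖x‖
    have e : (A * (r ^ (k + 1))⁻¹) * (r⁻¹ * (1 + (r⁻¹ * t) ^ 2)⁻¹) =
      A * ((t ^ (k+2))⁻¹ * ((t⁻¹ * r) ^ k * (1 + (t⁻¹ * r) ^ 2))⁻¹) := by
      rw [mul_pow t⁻¹ r k, inv_pow t k]
      field_simp
      ring
    rw [e]
    have : ‖f (t⁻¹ • x)‖ ≤ A * ((t⁻¹ * r) ^ k * (1 + (t⁻¹ * r) ^ 2))⁻¹ := by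
      rw [← div_eq_mul_inv, le_div_iff₀ (by positivity)]
      linarith
    calc _ ≤ (t ^ (k+2))⁻¹ * (A * ((t⁻¹ * r) ^ k * (1 + (t⁻¹ * r) ^ 2))⁻¹) := by gcongr
      _ = _ := by ring
  have hInteg := aux_int ‖x‖⁻¹ (inv_pos.2 hr)
  calc _ ≤ ∫ t in Set.Ioc a b,
        (A * (‖x‖ ^ (k + 1))⁻¹) * (‖x‖⁻¹ * (1 + (‖x‖⁻¹ * t) ^ 2)⁻¹) := by
        refine norm_integral_le_of_norm_le (hInteg.const_mul _).integrableOn ?_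
        exact (ae_restrict_iff' measurableSet_Ioc).2 (Eventually.of_forall key)
    _ ≤ (A * (‖x‖ ^ (k + 1))⁻¹) * Real.pi := by
        rw [integral_const_mul]
        gcongr
        exact aux_int_le _ (inv_pos.2 hr) _
    _ = _ := by ring

lemma aux_deriv {d : ℕ} (g : 𝓢(Eu d, ℝ)) (k : ℕ) (a b : ℝ) (ha : 0 < a) (x : Eu d) :
    HasFDerivAt (fun x => ∫ t in Set.Ioc a b, (t ^ k)⁻¹ • g (t⁻¹ • x))
      (∫ t in Set.Ioc a b, (t ^ (k + 1))⁻¹ • fderiv ℝ g (t⁻¹ • x)) x := by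
  obtain ⟨B, hB0, hB⟩ := aux_decay (SchwartzMap.fderivCLM ℝ (Eu d) ℝ g) 0
  have hB' : ∀ y, ‖fderiv ℝ g y‖ ≤ B := by
    intro y
    have := hB y
    rw [SchwartzMap.fderivCLM_apply] at this
    have h0 : 0 ≤ ‖y‖ ^ 2 * ‖fderiv ℝ g y‖ := by positivity
    nlinarith
  have hg := g.continuous
  have hdg : Continuous (fun y => fderiv ℝ g y) := (SchwartzMap.fderivCLM ℝ (Eu d) ℝ g).continuous
  have hcinv : ContinuousOn (fun t : ℝ => t⁻¹) (Set.Icc a b) :=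
    continuousOn_inv₀.mono fun t ht => (ha.trans_le ht.1).ne'
  have hcp : ∀ k : ℕ, ContinuousOn (fun t : ℝ => (t ^ k)⁻¹) (Set.Icc a b) := fun k =>
    ContinuousOn.inv₀ (by fun_prop) fun t ht => (pow_pos (ha.trans_le ht.1) k).ne'
  have hc : ∀ x, ContinuousOn (fun t : ℝ => (t ^ k)⁻¹ • g (t⁻¹ • x)) (Set.Icc a b) := fun x =>
    (hcp k).smul (hg.comp_continuousOn (hcinv.smul continuousOn_const))
  have hc' : ContinuousOn (fun t : ℝ => (t ^ (k + 1))⁻¹ • fderiv ℝ g (t⁻¹ • x)) (Set.Icc a b) :=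
    (hcp (k + 1)).smul (hdg.comp_continuousOn (hcinv.smul continuousOn_const))
  have hi : ∀ x, IntegrableOn (fun t : ℝ => (t ^ k)⁻¹ • g (t⁻¹ • x)) (Set.Ioc a b) := fun x =>
    ((hc x).integrableOn_Icc).mono_set Set.Ioc_subset_Icc_self
  refine hasFDerivAt_integral_of_dominated_of_fderiv_le (s := Set.univ)
    (F' := fun x t => (t ^ (k + 1))⁻¹ • fderiv ℝ g (t⁻¹ • x))
    (bound := fun t => (t ^ (k + 1))⁻¹ * B) univ_mem
    (Eventually.of_forall fun x => (hi x).aestronglyMeasurable) (hi x)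
    ((hc'.integrableOn_Icc).mono_set Set.Ioc_subset_Icc_self).aestronglyMeasurable ?_ ?_ ?_
  · refine (ae_restrict_iff' measurableSet_Ioc).2 (Eventually.of_forall fun t ht y _ => ?_)
    have ht0 : 0 < t := ha.trans ht.1
    rw [norm_smul, Real.norm_of_nonneg (by positivity)]
    gcongr
    exact hB' _
  · exact (((hcp (k + 1)).mul continuousOn_const).integrableOn_Icc).mono_set
      Set.Ioc_subset_Icc_self
  · refine (ae_restrict_iff' measurableSet_Ioc).2 (Eventually.of_forall fun t ht y _ => ?_)
    have h1 : HasFDerivAt g (fderiv ℝ g (t⁻¹ • y)) (t⁻¹ • y) :=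
      g.differentiableAt.hasFDerivAt
    have h2 : HasFDerivAt (fun y : Eu d => t⁻¹ • y) (t⁻¹ • ContinuousLinearMap.id ℝ (Eu d)) y :=
      (hasFDerivAt_id y).const_smul t⁻¹
    have h3 := (h1.comp y h2).const_smul ((t ^ k)⁻¹)
    refine h3.congr_fderiv ?_
    ext v
    simp [pow_succ]
    ring

lemma aux_fourier {d : ℕ} (g : 𝓢(Eu d, ℂ)) (a b : ℝ) (ha : 0 < a) (ξ : Eu d) :
    𝓕 (fun x => ∫ t in Set.Ioc a b, ((t ^ (d + 1))⁻¹ : ℝ) • g (t⁻¹ • x)) ξ =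
      ∫ t in Set.Ioc a b, (t⁻¹ : ℝ) • (𝓕 g) (t • ξ) := by
  have hsc : ∀ t ∈ Set.Ioc a b, ∀ {F : Type} [NormedAddCommGroup F] [NormedSpace ℝ F]
      (h : Eu d → F), ∫ x, ((t ^ (d + 1))⁻¹ : ℝ) • h (t⁻¹ • x) = t⁻¹ • ∫ y, h y := by
    intro t ht F _ _ h
    have ht0 : 0 < t := ha.trans ht.1
    rw [integral_smul, Measure.integral_comp_inv_smul_of_nonneg volume h ht0.le,
      finrank_euclideanSpace_fin, smul_smul]
    congr 1
    rw [pow_succ]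
    field_simp
  rw [Real.fourier_eq]
  have hInteg : Integrable (Function.uncurry fun (x : Eu d) (t : ℝ) =>
      Real.fourierChar (-inner ℝ x ξ) • (((t ^ (d + 1))⁻¹ : ℝ) • g (t⁻¹ • x)))
      (volume.prod (volume.restrict (Set.Ioc a b))) := by
    have hm : AEStronglyMeasurable (Function.uncurry fun (x : Eu d) (t : ℝ) =>
        Real.fourierChar (-inner ℝ x ξ) • (((t ^ (d + 1))⁻¹ : ℝ) • g (t⁻¹ • x)))
        (volume.prod (volume.restrict (Set.Ioc a b))) := by
      have h1 : Measurable (fun p : Eu d × ℝ => (p.2⁻¹ • p.1)) := by fun_prop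
      have h2 : Measurable (fun p : Eu d × ℝ => g (p.2⁻¹ • p.1)) := g.continuous.measurable.comp h1
      have h3 : Measurable (fun p : Eu d × ℝ => (p.2 ^ (d + 1))⁻¹) := by fun_prop
      have h4 : Continuous (fun p : Eu d × ℝ => (Real.fourierChar (-inner ℝ p.1 ξ) : ℂ)) := by
        fun_prop
      have h5 := h4.measurable.mul (h3.smul h2)
      exact h5.aestronglyMeasurable
    rw [integrable_prod_iff' hm]
    constructor
    · refine (ae_restrict_iff' measurableSet_Ioc).2 (Eventually.of_forall fun t ht => ?_)
      have ht0 : 0 < t := ha.trans ht.1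
      have h1 : Integrable (fun x : Eu d => ((t ^ (d + 1))⁻¹ : ℝ) • g (t⁻¹ • x)) :=
        (g.integrable.comp_smul (inv_pos.2 ht0).ne').smul ((t ^ (d + 1))⁻¹ : ℝ)
      exact (Real.fourierIntegral_convergent_iff ξ).2 h1
    · have : IntegrableOn (fun t : ℝ => t⁻¹ • ∫ y, ‖g y‖) (Set.Ioc a b) := by
        have hcinv : ContinuousOn (fun t : ℝ => t⁻¹) (Set.Icc a b) :=
          continuousOn_inv₀.mono fun t ht => (ha.trans_le ht.1).ne'
        exact ((hcinv.smul continuousOn_const).integrableOn_Icc).mono_set Set.Ioc_subset_Icc_self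
      refine this.congr_fun (fun t ht => ?_) measurableSet_Ioc
      have ht0 : 0 < t := ha.trans ht.1
      simp only [Function.uncurry, Circle.norm_smul]
      rw [← hsc t ht (fun y => ‖g y‖)]
      congr 1
      ext x
      rw [norm_smul, Real.norm_of_nonneg (by positivity), smul_eq_mul]
  have e1 : ∀ x : Eu d, Real.fourierChar (-inner ℝ x ξ) •
      (∫ t in Set.Ioc a b, ((t ^ (d + 1))⁻¹ : ℝ) • g (t⁻¹ • x)) =
      ∫ t in Set.Ioc a b, Real.fourierChar (-inner ℝ x ξ) •
        (((t ^ (d + 1))⁻¹ : ℝ) • g (t⁻¹ • x)) := by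
    intro x
    simp only [Circle.smul_def]
    rw [integral_smul]
  simp_rw [e1]
  rw [integral_integral_swap hInteg]
  refine setIntegral_congr_fun measurableSet_Ioc fun t ht => ?_
  have ht0 : 0 < t := ha.trans ht.1
  rw [SchwartzMap.fourier_coe, Real.fourier_eq,
    ← hsc t ht (fun y => Real.fourierChar (-inner ℝ y (t • ξ)) • g y)]
  congr 1
  ext x
  have : inner ℝ (t⁻¹ • x) (t • ξ) = inner ℝ x ξ := by
    rw [real_inner_smul_left, real_inner_smul_right]
    field_simp
  rw [this, smul_comm]

lemma aux_fourier_bound {d : ℕ} (ψ : 𝓢(Eu d, ℂ)) (i : Fin d) : ∃ A : ℝ, 0 < A ∧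
    ∀ a b : ℝ, 0 < a → ∀ ξ : Eu d,
      ‖∫ t in Set.Ioc a b, (t⁻¹ : ℝ) • (𝓕 (∂_{EuclideanSpace.single i (1 : ℝ)} ψ : 𝓢(Eu d, ℂ))) (t • ξ)‖
        ≤ A := by
  obtain ⟨A, hA, h⟩ := aux_decay (𝓕 ψ) 0
  refine ⟨2 * Real.pi * A * Real.pi, by positivity, fun a b ha ξ => ?_⟩
  have hF : ∀ η : Eu d, ‖(𝓕 (∂_{EuclideanSpace.single i (1 : ℝ)} ψ : 𝓢(Eu d, ℂ))) η‖ ≤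
      2 * Real.pi * A * (‖η‖ * (1 + ‖η‖ ^ 2)⁻¹) := by
    intro η
    rw [SchwartzMap.fourier_lineDerivOp_eq]
    rw [smul_apply, SchwartzMap.smulLeftCLM_apply_apply (by fun_prop)]
    rw [norm_smul, norm_smul]
    have h1 : ‖inner ℝ η (EuclideanSpace.single i (1 : ℝ))‖ ≤ ‖η‖ := by
      refine (norm_inner_le_norm _ _).trans ?_
      simp
    have h2 : ‖𝓕 ψ η‖ ≤ A * (1 + ‖η‖ ^ 2)⁻¹ := by
      rw [← div_eq_mul_inv, le_div_iff₀ (by positivity)]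
      have := h η
      linarith
    have h3 : ‖(2 * Real.pi * Complex.I : ℂ)‖ = 2 * Real.pi := by
      simp [abs_of_pos Real.pi_pos]
    rw [h3]
    calc _ ≤ 2 * Real.pi * (‖η‖ * (A * (1 + ‖η‖ ^ 2)⁻¹)) := by gcongr
      _ = _ := by ring
  rcases eq_or_ne ξ 0 with rfl | hξ
  · have h0 : (𝓕 (∂_{EuclideanSpace.single i (1 : ℝ)} ψ : 𝓢(Eu d, ℂ))) 0 = 0 := by
      simpa using hF 0
    simp only [smul_zero, h0, integral_zero, norm_zero]
    positivity
  have hr : 0 < ‖ξ‖ := norm_pos_iff.2 hξ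
  have hInteg := aux_int ‖ξ‖ hr
  calc _ ≤ ∫ t in Set.Ioc a b, 2 * Real.pi * A * (‖ξ‖ * (1 + (‖ξ‖ * t) ^ 2)⁻¹) := by
        refine norm_integral_le_of_norm_le (hInteg.const_mul _).integrableOn ?_
        refine (ae_restrict_iff' measurableSet_Ioc).2 (Eventually.of_forall fun t ht => ?_)
        have ht0 : 0 < t := ha.trans ht.1
        have := hF (t • ξ)
        rw [norm_smul, Real.norm_of_nonneg ht0.le] at this
        rw [norm_smul, Real.norm_of_nonneg (inv_pos.2 ht0).le]
        calc _ ≤ t⁻¹ * (2 * Real.pi * A * (t * ‖ξ‖ * (1 + (t * ‖ξ‖) ^ 2)⁻¹)) := by gcongr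
          _ = _ := by rw [mul_comm t ‖ξ‖]; field_simp
    _ ≤ _ := by
        rw [integral_const_mul]
        gcongr
        exact aux_int_le _ hr _

/-- **Uniform Calderón–Zygmund bounds for the dyadically averaged kernel**
(from the proof of Theorem `thm:quantitative2`): for a Schwartz function `φ` and
`K'_{i,j}(x) = ∫_{δ₁}^{δ₂} (∂(x_j φ)/∂x_i)(x/δ) δ^{-d-1} dδ`, the Calderón–Zygmund bounds
hold with a constant independent of `0 < δ₁ < δ₂`. -/
theorem averaged_kernel_CZ_bounds
    (d : ℕ) (hd : 1 ≤ d) (φ : 𝓢(Eu d, ℝ)) (i j : Fin d) :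
    ∃ C : ℝ, 0 < C ∧
      ∀ δ₁ δ₂ : ℝ, 0 < δ₁ → δ₁ < δ₂ →
        ∀ K' : Eu d → ℝ,
          (∀ x : Eu d, K' x =
            ∫ δ in Set.Ioc δ₁ δ₂,
              fderiv ℝ (fun y : Eu d => y j * φ y) (δ⁻¹ • x)
                  (EuclideanSpace.single i 1) * δ ^ (-(d : ℝ) - 1)) →
          ((∀ x : Eu d, x ≠ 0 → |K' x| ≤ C * ‖x‖ ^ (-(d : ℝ))) ∧
           (∀ x : Eu d, x ≠ 0 → ‖gradient K' x‖ ≤ C * ‖x‖ ^ (-(d : ℝ) - 1)) ∧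
           (∀ ξ : Eu d, ‖𝓕 (fun x => (K' x : ℂ)) ξ‖ ≤ C)) := by
  have htg : (fun y : Eu d => y j).HasTemperateGrowth :=
    (EuclideanSpace.proj j : Eu d →L[ℝ] ℝ).hasTemperateGrowth
  set ψ : 𝓢(Eu d, ℝ) := SchwartzMap.smulLeftCLM ℝ (fun y : Eu d => y j) φ with hψ
  have hψ' : (fun y : Eu d => y j * φ y) = ψ := by
    rw [hψ, SchwartzMap.smulLeftCLM_apply htg]
    rfl
  set e : Eu d := EuclideanSpace.single i 1 with he
  set g : 𝓢(Eu d, ℝ) := ∂_{e} ψ with hg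
  have hgf : ∀ y, fderiv ℝ (fun y : Eu d => y j * φ y) y e = g y := by
    intro y
    rw [hψ', hg, SchwartzMap.lineDerivOp_apply_eq_fderiv]
  set ψc : 𝓢(Eu d, ℂ) := ψ.postcompCLM (Complex.ofRealCLM) with hψc
  have hgc : ∀ y, (∂_{e} ψc : 𝓢(Eu d, ℂ)) y = (g y : ℂ) := by
    intro y
    rw [hg, SchwartzMap.lineDerivOp_apply_eq_fderiv, SchwartzMap.lineDerivOp_apply_eq_fderiv]
    have h1 : HasFDerivAt ψ (fderiv ℝ ψ y) y := ψ.differentiableAt.hasFDerivAt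
    have h2 : HasFDerivAt ψc (Complex.ofRealCLM.comp (fderiv ℝ ψ y)) y :=
      Complex.ofRealCLM.hasFDerivAt.comp y h1
    rw [h2.fderiv]
    rfl
  obtain ⟨A, hA, hA'⟩ := aux_decay g (d - 1)
  obtain ⟨B, hB, hB'⟩ := aux_decay (SchwartzMap.fderivCLM ℝ (Eu d) ℝ g) d
  obtain ⟨D, hD, hD'⟩ := aux_fourier_bound ψc i
  refine ⟨A * Real.pi + B * Real.pi + D, by positivity, fun a b ha hab K' hK => ?_⟩
  have hK' : K' = fun x => ∫ t in Set.Ioc a b, (t ^ (d + 1))⁻¹ • g (t⁻¹ • x) := by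
    ext x
    rw [hK]
    refine setIntegral_congr_fun measurableSet_Ioc fun t ht => ?_
    have ht0 : 0 < t := ha.trans ht.1
    simp only
    rw [hgf, smul_eq_mul, mul_comm]
    congr 1
    rw [← Real.rpow_natCast, ← Real.rpow_neg ht0.le]
    congr 1
    push_cast
    ring
  refine ⟨fun x hx => ?_, fun x hx => ?_, fun ξ => ?_⟩
  · have hr : 0 < ‖x‖ := norm_pos_iff.2 hx
    have := aux_kernel g (d - 1) A hA hA' a b ha x hx
    rw [show d - 1 + 2 = d + 1 by omega, show d - 1 + 1 = d by omega] at this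
    rw [hK', Real.rpow_neg hr.le, Real.rpow_natCast, ← Real.norm_eq_abs]
    refine this.trans ?_
    gcongr
    nlinarith [Real.pi_pos, mul_pos hB Real.pi_pos]
  · have hr : 0 < ‖x‖ := norm_pos_iff.2 hx
    have := aux_kernel _ d B hB hB' a b ha x hx
    simp only [SchwartzMap.fderivCLM_apply] at this
    have hder := aux_deriv g (d + 1) a b ha x
    rw [← hK'] at hder
    rw [gradient, LinearIsometryEquiv.norm_map, hder.fderiv]
    rw [show -(d : ℝ) - 1 = -((d + 1 : ℕ) : ℝ) by push_cast; ring, Real.rpow_neg hr.le,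
      Real.rpow_natCast]
    refine this.trans ?_
    gcongr
    nlinarith [Real.pi_pos, mul_pos hA Real.pi_pos]
  · have h1 : (fun x => (K' x : ℂ)) = fun x => ∫ t in Set.Ioc a b,
        ((t ^ (d + 1))⁻¹ : ℝ) • (∂_{e} ψc : 𝓢(Eu d, ℂ)) (t⁻¹ • x) := by
      ext x
      rw [hK']
      simp only
      rw [← integral_complex_ofReal]
      congr 1
      ext t
      rw [hgc]
      simp
    rw [h1, aux_fourier _ a b ha ξ]
    refine (hD' a b ha ξ).trans ?_
    nlinarith [mul_pos hA Real.pi_pos, mul_pos hB Real.pi_pos]
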